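/- arXiv:0711.4829 — 3 statements merged into one kernel-verified Lean document; each statement's English description precedes it below -/
import Mathlib

section
/- There exists a constant c > 0 such that for every n ≥ 2, every connected triangle-free simple graph on n vertices contains an induced tree on at least exp(c·√(log n)) vertices. -/
namespace SimpleGraph

variable {V : Type*} {G : SimpleGraph V}

/-- Finite vertex sets obtained from `{r}` by successively adding a vertex with exactly one
neighbour in the current set. -/
inductive IsLeafGrown [DecidableEq V] (G : SimpleGraph V) (r : V) : Finset V → Prop
  | single : IsLeafGrown G r {r}
  | leaf {S : Finset V} {u x : V} (hS : IsLeafGrown G r S) (hu : u ∈ S) (hx : x ∉ S)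
      (hadj : ∀ y ∈ S, G.Adj x y ↔ y = u) : IsLeafGrown G r (insert x S)

/-- `x` can be reached from `v` by a walk all of whose vertices after the first lie in `S`. -/
def ReachableWithin (G : SimpleGraph V) (S : Finset V) (v x : V) : Prop :=
  Relation.ReflTransGen (fun a b => G.Adj a b ∧ b ∈ S) v x

theorem ReachableWithin.step {S : Finset V} {v x y : V} (h : G.ReachableWithin S v x)
    (hxy : G.Adj x y) (hy : y ∈ S) : G.ReachableWithin S v y :=
  Relation.ReflTransGen.tail h ⟨hxy, hy⟩

theorem Connected.reachableWithin_univ [Fintype V] (hG : G.Connected) (v x : V) :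
    G.ReachableWithin Finset.univ v x := by
  have h := (reachable_iff_reflTransGen v x).1 (hG.preconnected v x)
  exact Relation.ReflTransGen.mono (fun a b hab => ⟨hab, Finset.mem_univ b⟩) _ _ h

section Trees

variable [DecidableEq V]

theorem IsAcyclic.induce_insert {S : Finset V} {u x : V}
    (h : (G.induce (S : Set V)).IsAcyclic) (hadj : ∀ y ∈ S, G.Adj x y → y = u) :
    (G.induce ((insert x S : Finset V) : Set V)).IsAcyclic := by
  intro v c hc
  by_cases hx : ∃ z ∈ c.support, (z : V) = x
  · obtain ⟨z, hz, hzx⟩ := hx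
    have hc' := hc.rotate hz
    have key : ∀ w, (G.induce ((insert x S : Finset V) : Set V)).Adj z w → (w : V) = u := by
      intro w hw
      have hw' : G.Adj (z : V) w := hw
      rw [hzx] at hw'
      have hm := w.2
      simp only [Finset.coe_insert, Set.mem_insert_iff, Finset.mem_coe] at hm
      exact hadj w (hm.resolve_left hw'.ne') hw'
    refine hc'.snd_ne_penultimate (Subtype.ext ?_)
    rw [key _ ((c.rotate z hz).adj_snd hc'.not_nil),
      key _ ((c.rotate z hz).adj_penultimate hc'.not_nil).symm]
  · push Not at hx
    let c' := c.map (Embedding.induce _).toHom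
    have hc' : c'.IsCycle := hc.map Subtype.val_injective
    have hs : ∀ z ∈ c'.support, z ∈ (S : Set V) := by
      intro z hz
      simp only [c', Walk.support_map, List.mem_map] at hz
      obtain ⟨y, hy, rfl⟩ := hz
      have hm := y.2
      simp only [Finset.coe_insert, Set.mem_insert_iff] at hm
      exact hm.resolve_left (hx y hy)
    refine h (c'.induce _ hs) ?_
    refine (Walk.isCycle_map_iff_of_injective
      (f := (Embedding.induce (S : Set V)).toHom) Subtype.val_injective).1 ?_
    rw [Walk.map_induce]
    exact hc'

theorem IsLeafGrown.root_mem {r : V} {S : Finset V} (h : G.IsLeafGrown r S) : r ∈ S := by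
  induction h with
  | single => simp
  | leaf _ _ _ _ ih => exact Finset.mem_insert_of_mem ih

theorem IsLeafGrown.isTree {r : V} {S : Finset V} (h : G.IsLeafGrown r S) :
    (G.induce (S : Set V)).IsTree := by
  induction h with
  | single =>
    have : Subsingleton (({r} : Finset V) : Set V) := by simp
    have : Nonempty (({r} : Finset V) : Set V) := ⟨⟨r, by simp⟩⟩
    exact IsTree.of_subsingleton
  | @leaf S u x _ hu hx hadj ih =>
    refine ⟨?_, ih.isAcyclic.induce_insert fun y hy => (hadj y hy).1⟩
    have hpair := induce_pair_connected_of_adj ((hadj u hu).2 rfl)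
    have heq : ((insert x S : Finset V) : Set V) = {x, u} ∪ (S : Set V) := by
      ext z
      simp only [Finset.coe_insert, Set.mem_insert_iff, Set.mem_union, Set.mem_singleton_iff,
        Finset.mem_coe]
      grind
    rw [heq]
    exact induce_union_connected hpair.preconnected ih.connected.preconnected ⟨u, by simp, hu⟩

/-- Two disjoint leaf-grown sets joined by exactly one edge, at the root of the second one. -/
theorem IsLeafGrown.union {r x y : V} {S T : Finset V} (hS : G.IsLeafGrown r S)
    (hT : G.IsLeafGrown y T) (hx : x ∈ S) (hd : Disjoint S T)
    (hadj : ∀ a ∈ S, ∀ b ∈ T, G.Adj a b ↔ a = x ∧ b = y) : G.IsLeafGrown r (S ∪ T) := by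
  induction hT with
  | single =>
    rw [Finset.union_comm, ← Finset.insert_eq]
    refine hS.leaf hx (by simpa using hd) fun a ha => ?_
    rw [G.adj_comm, hadj a ha y (by simp)]
    simp
  | @leaf T u z hT hu hz hz' ih =>
    rw [Finset.disjoint_insert_right] at hd
    rw [Finset.union_insert]
    have hzy : z ≠ y := fun h => hz (h ▸ hT.root_mem)
    refine (ih hd.2 fun a ha b hb => hadj a ha b (Finset.mem_insert_of_mem hb)).leaf
      (Finset.mem_union_right _ hu) (by simp [hd.1, hz]) fun a ha => ?_
    rcases Finset.mem_union.1 ha with ha | ha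
    · rw [G.adj_comm, hadj a ha z (Finset.mem_insert_self _ _)]
      have : a ≠ u := fun h => Finset.disjoint_left.1 hd.2 ha (h ▸ hu)
      simp [hzy, this]
    · exact hz' a ha

theorem IsLeafGrown.star {v : V} {A : Finset V} (hA : ∀ a ∈ A, G.Adj v a)
    (hind : ∀ a ∈ A, ∀ b ∈ A, ¬ G.Adj a b) : G.IsLeafGrown v (insert v A) := by
  induction A using Finset.induction_on with
  | empty => exact IsLeafGrown.single
  | insert a A ha ih =>
    rw [Finset.insert_comm]
    have hva := hA a (Finset.mem_insert_self _ _)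
    refine (ih (fun b hb => hA b (Finset.mem_insert_of_mem hb)) fun b hb c hc =>
      hind b (Finset.mem_insert_of_mem hb) c (Finset.mem_insert_of_mem hc)).leaf
      (Finset.mem_insert_self v A) (by simp [ha, hva.ne']) fun y hy => ?_
    rcases Finset.mem_insert.1 hy with rfl | hy
    · simp [hva.symm]
    · have h1 := hind a (Finset.mem_insert_self _ _) y (Finset.mem_insert_of_mem hy)
      have h2 := (hA y (Finset.mem_insert_of_mem hy)).ne'
      simp [h1, h2]

end Trees

section Separation

open scoped Classical in
/-- The vertices of `S` reachable from `v` inside `S` without using `w`. -/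
noncomputable def reachAvoiding (G : SimpleGraph V) (S : Finset V) (v w : V) : Finset V :=
  {x ∈ S | G.ReachableWithin (S.erase w) v x}

open scoped Classical in
/-- The vertices of `S` that `w` separates from `v` inside `S`, including `w` itself. -/
noncomputable def separatedPart (G : SimpleGraph V) (S : Finset V) (v w : V) : Finset V :=
  S \ G.reachAvoiding S v w

variable {S : Finset V} {v w w' x y : V}

theorem reachAvoiding_subset : G.reachAvoiding S v w ⊆ S := by
  classical exact Finset.filter_subset _ _

theorem separatedPart_subset : G.separatedPart S v w ⊆ S := by
  classical exact Finset.sdiff_subset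

theorem mem_separatedPart : x ∈ G.separatedPart S v w ↔ x ∈ S ∧ x ∉ G.reachAvoiding S v w := by
  classical simp [separatedPart]

theorem card_reachAvoiding_add_card_separatedPart :
    (G.reachAvoiding S v w).card + (G.separatedPart S v w).card = S.card := by
  classical
  rw [add_comm]
  exact Finset.card_sdiff_add_card_eq_card reachAvoiding_subset

theorem self_mem_reachAvoiding (hv : v ∈ S) : v ∈ G.reachAvoiding S v w := by
  classical exact Finset.mem_filter.2 ⟨hv, .refl⟩

theorem mem_reachAvoiding_of_adj (hx : x ∈ G.reachAvoiding S v w) (hxy : G.Adj x y)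
    (hy : y ∈ S) (hyw : y ≠ w) : y ∈ G.reachAvoiding S v w := by
  classical
  exact Finset.mem_filter.2
    ⟨hy, (Finset.mem_filter.1 hx).2.step hxy (Finset.mem_erase.2 ⟨hyw, hy⟩)⟩

theorem notMem_reachAvoiding (hvw : v ≠ w) : w ∉ G.reachAvoiding S v w := by
  classical
  intro h
  rcases Relation.ReflTransGen.cases_tail (Finset.mem_filter.1 h).2 with h | ⟨_, _, _, h⟩
  · exact hvw h.symm
  · simp at h

theorem reachableWithin_reachAvoiding (hx : x ∈ G.reachAvoiding S v w) :
    G.ReachableWithin (G.reachAvoiding S v w) v x := by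
  classical
  have h := (Finset.mem_filter.1 hx).2
  clear hx
  induction h with
  | refl => exact .refl
  | @tail b c hb hbc ih =>
    exact ih.step hbc.1 (Finset.mem_filter.2
      ⟨Finset.mem_of_mem_erase hbc.2, Relation.ReflTransGen.tail hb hbc⟩)

theorem reachableWithin_separatedPart (hv : v ∈ S) (hS : ∀ x ∈ S, G.ReachableWithin S v x)
    (hx : x ∈ G.separatedPart S v w) : G.ReachableWithin (G.separatedPart S v w) w x := by
  suffices h : x ∈ G.reachAvoiding S v w ∨ G.ReachableWithin (G.separatedPart S v w) w x from
    h.resolve_left (mem_separatedPart.1 hx).2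
  have h := hS x (separatedPart_subset hx)
  clear hx
  induction h with
  | refl => exact .inl (self_mem_reachAvoiding hv)
  | @tail b c _ hbc ih =>
    by_cases hc : c ∈ G.reachAvoiding S v w
    · exact .inl hc
    · refine .inr ?_
      by_cases hcw : c = w
      · rw [hcw]; exact .refl
      · rcases ih with ih | ih
        · exact absurd (mem_reachAvoiding_of_adj ih hbc.1 hbc.2 hcw) hc
        · exact ih.step hbc.1 (mem_separatedPart.2 ⟨hbc.2, hc⟩)

theorem separatedPart_subset_reachAvoiding (hv : v ∈ S)
    (hS : ∀ x ∈ S, G.ReachableWithin S v x) (hw : w ∈ S) (hw' : w' ∈ S) (hvw : G.Adj v w)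
    (hvw' : G.Adj v w') (hne : w ≠ w') :
    G.separatedPart S v w ⊆ G.reachAvoiding S v w' := by
  intro x hx
  have h := reachableWithin_separatedPart hv hS hx
  clear hx
  induction h with
  | refl => exact mem_reachAvoiding_of_adj (self_mem_reachAvoiding hv) hvw hw hne
  | @tail b c _ hbc ih =>
    refine mem_reachAvoiding_of_adj ih hbc.1 (separatedPart_subset hbc.2) ?_
    rintro rfl
    exact (mem_separatedPart.1 hbc.2).2
      (mem_reachAvoiding_of_adj (self_mem_reachAvoiding hv) hvw' hw' hne.symm)

theorem eq_of_adj_of_mem_separatedPart (hv : v ∈ S) (hvx : G.Adj v x)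
    (hx : x ∈ G.separatedPart S v w) : x = w := by
  by_contra hne
  exact (mem_separatedPart.1 hx).2 (mem_reachAvoiding_of_adj (self_mem_reachAvoiding hv) hvx
    (separatedPart_subset hx) hne)

theorem reachAvoiding_subset_singleton (h : ∀ y ∈ S, G.Adj v y → y = w) :
    G.reachAvoiding S v w ⊆ {v} := by
  classical
  intro x hx
  have hr := (Finset.mem_filter.1 hx).2
  clear hx
  induction hr with
  | refl => simp
  | @tail b c _ hbc ih =>
    rw [Finset.mem_singleton] at ih
    subst ih
    exact absurd (h c (Finset.mem_of_mem_erase hbc.2) hbc.1) (Finset.ne_of_mem_erase hbc.2)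

end Separation

section Growth

/-- Every finite vertex set `S` with at least `N` vertices, all reachable from `v` inside `S`,
contains a leaf-grown set with root `v` and at least `k` vertices. -/
def HasLargeRootedTrees [DecidableEq V] (G : SimpleGraph V) (k N : ℕ) : Prop :=
  ∀ (S : Finset V) (v : V), v ∈ S → (∀ x ∈ S, G.ReachableWithin S v x) → N ≤ S.card →
    ∃ T ⊆ S, G.IsLeafGrown v T ∧ k ≤ T.card

variable [DecidableEq V]

theorem hasLargeRootedTrees_two : G.HasLargeRootedTrees 2 2 := by
  intro S v hv hS hcard
  obtain ⟨x, hx, hxv⟩ := Finset.exists_mem_ne hcard v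
  rcases Relation.ReflTransGen.cases_head (hS x hx) with h | ⟨w, ⟨hvw, hw⟩, _⟩
  · exact absurd h.symm hxv
  · refine ⟨{v, w}, by simp [Finset.insert_subset_iff, hv, hw],
      IsLeafGrown.star (by simpa using hvw) (by simp), ?_⟩
    rw [Finset.card_pair hvw.ne]

theorem exists_isLeafGrown_of_separatedParts (hG : G.CliqueFree 3) {k N : ℕ}
    (hkN : G.HasLargeRootedTrees k N) {S : Finset V} {v w w' : V} (hv : v ∈ S)
    (hS : ∀ x ∈ S, G.ReachableWithin S v x) (hw : w ∈ S) (hw' : w' ∈ S) (hvw : G.Adj v w)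
    (hvw' : G.Adj v w') (hne : w ≠ w') (hN : N ≤ (G.separatedPart S v w).card)
    (hN' : N ≤ (G.separatedPart S v w').card) :
    ∃ T ⊆ S, G.IsLeafGrown v T ∧ 2 * k ≤ T.card := by
  obtain ⟨T, hTS, hT, hTk⟩ := hkN _ w
    (mem_separatedPart.2 ⟨hw, notMem_reachAvoiding hvw.ne⟩)
    (fun x hx => reachableWithin_separatedPart hv hS hx) hN
  obtain ⟨T', hTS', hT', hTk'⟩ := hkN _ w'
    (mem_separatedPart.2 ⟨hw', notMem_reachAvoiding hvw'.ne⟩)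
    (fun x hx => reachableWithin_separatedPart hv hS hx) hN'
  have hvT : v ∉ T := fun h => (mem_separatedPart.1 (hTS h)).2 (self_mem_reachAvoiding hv)
  have hvT' : v ∉ T' := fun h => (mem_separatedPart.1 (hTS' h)).2 (self_mem_reachAvoiding hv)
  have hsub := separatedPart_subset_reachAvoiding hv hS hw hw' hvw hvw' hne
  have hsub' := separatedPart_subset_reachAvoiding hv hS hw' hw hvw' hvw hne.symm
  have hd : Disjoint T T' := Finset.disjoint_left.2 fun a ha ha' =>
    (mem_separatedPart.1 (hTS' ha')).2 (hsub (hTS ha))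
  have hno : ∀ a ∈ T, ∀ b ∈ T', ¬ G.Adj a b := by
    intro a ha b hb hab
    have hb' : b = w' := by
      by_contra hbw
      exact (mem_separatedPart.1 (hTS' hb)).2 (mem_reachAvoiding_of_adj (hsub (hTS ha)) hab
        (separatedPart_subset (hTS' hb)) hbw)
    have ha' : a = w := by
      by_contra haw
      exact (mem_separatedPart.1 (hTS ha)).2 (mem_reachAvoiding_of_adj (hsub' (hTS' hb)) hab.symm
        (separatedPart_subset (hTS ha)) haw)
    subst ha' hb'
    exact hG {v, a, b} (is3Clique_triple_iff.2 ⟨hvw, hvw', hab⟩)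
  have h1 : G.IsLeafGrown v ({v} ∪ T) := by
    refine IsLeafGrown.single.union hT (x := v) (by simp) (by simpa using hvT) ?_
    intro a ha b hb
    rw [Finset.mem_singleton] at ha
    subst ha
    constructor
    · exact fun h => ⟨rfl, eq_of_adj_of_mem_separatedPart hv h (hTS hb)⟩
    · rintro ⟨-, rfl⟩
      exact hvw
  refine ⟨({v} ∪ T) ∪ T', ?_, h1.union hT' (x := v) (by simp) ?_ ?_, ?_⟩
  · exact Finset.union_subset (Finset.union_subset (by simpa using hv)
      (hTS.trans separatedPart_subset)) (hTS'.trans separatedPart_subset)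
  · exact Finset.disjoint_union_left.2 ⟨by simpa using hvT', hd⟩
  · intro a ha b hb
    rcases Finset.mem_union.1 ha with ha | ha
    · rw [Finset.mem_singleton] at ha
      subst ha
      constructor
      · exact fun h => ⟨rfl, eq_of_adj_of_mem_separatedPart hv h (hTS' hb)⟩
      · rintro ⟨-, rfl⟩
        exact hvw'
    · simp only [hno a ha b hb, false_iff, not_and]
      exact fun h => absurd (h ▸ ha) hvT
  · have h2 : (T ∪ T').card ≤ (({v} ∪ T) ∪ T').card :=
      Finset.card_le_card (Finset.union_subset_union_left Finset.subset_union_right)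
    rw [Finset.card_union_of_disjoint hd] at h2
    omega

open scoped Classical in
theorem exists_isLeafGrown_of_le_card (hG : G.CliqueFree 3) {k N : ℕ} (hk : 0 < k) (hN : 0 < N)
    (hkN : G.HasLargeRootedTrees k N) (S : Finset V) (v : V) (j : ℕ) (hv : v ∈ S)
    (hS : ∀ x ∈ S, G.ReachableWithin S v x)
    (hcard : j * (2 * k * N) + min (S.filter (G.Adj v)).card (2 * k) * N ≤ S.card) :
    ∃ T ⊆ S, G.IsLeafGrown v T ∧ min (2 * k) (j + 1) ≤ T.card := by
  induction hn : S.card using Nat.strong_induction_on generalizing S v j with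
  | _ n ih =>
  subst hn
  rcases Nat.eq_zero_or_pos j with rfl | hj
  · exact ⟨{v}, by simpa using hv, .single, by simp⟩
  obtain ⟨i, rfl⟩ : ∃ i, j = i + 1 := ⟨j - 1, by omega⟩
  set A := S.filter (G.Adj v)
  have hmemA : ∀ a, a ∈ A ↔ a ∈ S ∧ G.Adj v a := fun a => Finset.mem_filter
  have hkN1 : 2 ≤ 2 * k * N := by nlinarith [Nat.mul_pos hk hN]
  by_cases hdeg : 2 * k ≤ A.card
  · refine ⟨insert v A, Finset.insert_subset hv (Finset.filter_subset _ _),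
      IsLeafGrown.star (fun a ha => ((hmemA a).1 ha).2) ?_, ?_⟩
    · intro a ha b hb hab
      exact hG {v, a, b} (is3Clique_triple_iff.2 ⟨((hmemA a).1 ha).2, ((hmemA b).1 hb).2, hab⟩)
    · have := Finset.card_le_card (Finset.subset_insert v A)
      omega
  push Not at hdeg
  rw [min_eq_left hdeg.le] at hcard
  rcases Nat.lt_or_ge 1 A.card with hA1 | hA1
  · by_cases hsmall : ∃ w ∈ A, (G.separatedPart S v w).card < N
    · obtain ⟨w, hwA, hw⟩ := hsmall
      obtain ⟨hwS, hvw⟩ := (hmemA w).1 hwA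
      have hsum := card_reachAvoiding_add_card_separatedPart (G := G) (S := S) (v := v) (w := w)
      have hpos : 0 < (G.separatedPart S v w).card :=
        Finset.card_pos.2 ⟨w, mem_separatedPart.2 ⟨hwS, notMem_reachAvoiding hvw.ne⟩⟩
      have hle : ((G.reachAvoiding S v w).filter (G.Adj v)).card ≤ A.card - 1 := by
        rw [← Finset.card_erase_of_mem hwA]
        refine Finset.card_le_card fun a ha => ?_
        obtain ⟨ha1, ha2⟩ := Finset.mem_filter.1 ha
        refine Finset.mem_erase.2 ⟨?_, (hmemA a).2 ⟨reachAvoiding_subset ha1, ha2⟩⟩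
        rintro rfl
        exact notMem_reachAvoiding hvw.ne ha1
      obtain ⟨T, hT, hT'⟩ := ih _ (by omega) (G.reachAvoiding S v w) v (i + 1)
        (self_mem_reachAvoiding hv) (fun x hx => reachableWithin_reachAvoiding hx) (by
          have h1 := Nat.mul_le_mul_right N ((min_le_left _ (2 * k)).trans hle)
          have h2 : (A.card - 1) * N + N = A.card * N := by
            rw [← Nat.succ_mul, Nat.succ_eq_add_one, Nat.sub_add_cancel hA1.le]
          omega) rfl
      exact ⟨T, hT.trans reachAvoiding_subset, hT'⟩
    · push Not at hsmall
      obtain ⟨w, hw, w', hw', hne⟩ := Finset.one_lt_card.1 hA1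
      obtain ⟨T, hTS, hT, hTk⟩ := exists_isLeafGrown_of_separatedParts hG hkN hv hS
        ((hmemA w).1 hw).1 ((hmemA w').1 hw').1 ((hmemA w).1 hw).2 ((hmemA w').1 hw').2 hne
        (hsmall w hw) (hsmall w' hw')
      exact ⟨T, hTS, hT, (min_le_left _ _).trans hTk⟩
  · have hS2 : 2 ≤ S.card := by nlinarith
    obtain ⟨x, hx, hxv⟩ := Finset.exists_mem_ne hS2 v
    rcases Relation.ReflTransGen.cases_head (hS x hx) with h | ⟨w, ⟨hvw, hw⟩, _⟩
    · exact absurd h.symm hxv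
    have huniq : ∀ y ∈ S, G.Adj v y → y = w := fun y hy hvy =>
      Finset.card_le_one.1 hA1 y ((hmemA y).2 ⟨hy, hvy⟩) w ((hmemA w).2 ⟨hw, hvw⟩)
    have hAcard : A.card = 1 :=
      le_antisymm hA1 (Finset.card_pos.2 ⟨w, (hmemA w).2 ⟨hw, hvw⟩⟩)
    have hsum := card_reachAvoiding_add_card_separatedPart (G := G) (S := S) (v := v) (w := w)
    have hone : (G.reachAvoiding S v w).card = 1 := by
      refine le_antisymm ?_ (Finset.card_pos.2 ⟨v, self_mem_reachAvoiding hv⟩)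
      simpa using Finset.card_le_card (reachAvoiding_subset_singleton huniq)
    obtain ⟨T, hTS, hT, hTk⟩ := ih _ (by omega) (G.separatedPart S v w) w i
      (mem_separatedPart.2 ⟨hw, notMem_reachAvoiding hvw.ne⟩)
      (fun x hx => reachableWithin_separatedPart hv hS hx) (by
        have h1 := Nat.mul_le_mul_right N
          (min_le_right ((G.separatedPart S v w).filter (G.Adj w)).card (2 * k))
        rw [hAcard, Nat.succ_mul] at hcard
        omega) rfl
    have hvT : v ∉ T := fun h => (mem_separatedPart.1 (hTS h)).2 (self_mem_reachAvoiding hv)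
    refine ⟨{v} ∪ T, Finset.union_subset (by simpa using hv) (hTS.trans separatedPart_subset),
      IsLeafGrown.single.union hT (x := v) (by simp) (by simpa using hvT) ?_, ?_⟩
    · intro a ha b hb
      rw [Finset.mem_singleton] at ha
      subst ha
      constructor
      · exact fun h => ⟨rfl, eq_of_adj_of_mem_separatedPart hv h (hTS hb)⟩
      · rintro ⟨-, rfl⟩
        exact hvw
    · rw [Finset.card_union_of_disjoint (by simpa using hvT), Finset.card_singleton]
      omega

theorem HasLargeRootedTrees.double (hG : G.CliqueFree 3) {k N : ℕ} (hk : 0 < k) (hN : 0 < N)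
    (hkN : G.HasLargeRootedTrees k N) : G.HasLargeRootedTrees (2 * k) (4 * k ^ 2 * N) := by
  classical
  intro S v hv hS hcard
  obtain ⟨T, hTS, hT, hTk⟩ :=
    exists_isLeafGrown_of_le_card hG hk hN hkN S v (2 * k - 1) hv hS (by
      refine le_trans ?_ hcard
      have h1 := Nat.mul_le_mul_right N (min_le_right (S.filter (G.Adj v)).card (2 * k))
      obtain ⟨i, rfl⟩ : ∃ i, k = i + 1 := ⟨k - 1, by omega⟩
      have h2 : 2 * (i + 1) - 1 = 2 * i + 1 := by omega
      rw [h2]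
      nlinarith)
  exact ⟨T, hTS, hT, by omega⟩

theorem hasLargeRootedTrees_two_pow (hG : G.CliqueFree 3) (m : ℕ) :
    G.HasLargeRootedTrees (2 ^ (m + 1)) (2 ^ (m ^ 2 + 3 * m + 1)) := by
  induction m with
  | zero => exact hasLargeRootedTrees_two
  | succ m ih =>
    convert ih.double hG (by positivity) (by positivity) using 1 <;> ring

end Growth

end SimpleGraph

theorem Nat.exists_two_pow_quadratic_le_lt {n : ℕ} (hn : 2 ≤ n) :
    ∃ m : ℕ, 2 ^ (m ^ 2 + 3 * m + 1) ≤ n ∧ n < 2 ^ ((m + 1) ^ 2 + 3 * (m + 1) + 1) := by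
  have hex : ∃ m : ℕ, n < 2 ^ (m ^ 2 + 3 * m + 1) :=
    ⟨n, Nat.lt_two_pow_self.trans_le (Nat.pow_le_pow_right two_pos (by nlinarith))⟩
  obtain ⟨m, hm⟩ : ∃ m, Nat.find hex = m + 1 := by
    refine Nat.exists_eq_succ_of_ne_zero fun h => ?_
    have := Nat.find_spec hex
    rw [h] at this
    norm_num at this
    omega
  exact ⟨m, not_lt.1 (Nat.find_min hex (by omega)), hm ▸ Nat.find_spec hex⟩

theorem Real.exp_sqrt_log_le_two_pow {n m : ℕ} (hn : 2 ≤ n)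
    (hm : n < 2 ^ ((m + 1) ^ 2 + 3 * (m + 1) + 1)) :
    Real.exp (Real.log 2 / 3 * Real.sqrt (Real.log n)) ≤ (2 : ℝ) ^ (m + 1) := by
  have hn0 : (0 : ℝ) < n := by exact_mod_cast (by omega : 0 < n)
  have h2 : 0 < Real.log 2 := Real.log_pos one_lt_two
  have h2' : Real.log 2 ≤ 1 := by linarith [Real.log_two_lt_d9]
  have hlog : Real.log n ≤ (((m + 1) ^ 2 + 3 * (m + 1) + 1 : ℕ) : ℝ) * Real.log 2 := by
    rw [← Real.log_pow]
    exact Real.log_le_log hn0 (by exact_mod_cast hm.le)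
  have hm0 : (0 : ℝ) ≤ m := m.cast_nonneg
  have hsqrt : Real.sqrt (Real.log n) ≤ 3 * (m + 1) := by
    refine Real.sqrt_le_iff.2 ⟨by positivity, hlog.trans ?_⟩
    push_cast
    nlinarith
  calc Real.exp (Real.log 2 / 3 * Real.sqrt (Real.log n))
      ≤ Real.exp (Real.log 2 / 3 * (3 * (m + 1))) := by gcongr
    _ = Real.exp (Real.log ((2 : ℝ) ^ (m + 1))) := by
        rw [Real.log_pow]
        push_cast
        ring_nf
    _ = 2 ^ (m + 1) := Real.exp_log (by positivity)

/-- There exists a constant `c > 0` such that for every `n ≥ 2`, every connected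
triangle-free simple graph on `n` vertices contains an induced tree on at least
`exp (c * √(log n))` vertices. -/
theorem stmt_0 :
    ∃ c : ℝ, 0 < c ∧
      ∀ (n : ℕ), 2 ≤ n →
        ∀ (V : Type) [Fintype V] (G : SimpleGraph V),
          Fintype.card V = n → G.Connected → G.CliqueFree 3 →
          ∃ S : Finset V, (G.induce (S : Set V)).IsTree ∧
            Real.exp (c * Real.sqrt (Real.log n)) ≤ (S.card : ℝ) := by
  refine ⟨Real.log 2 / 3, div_pos (Real.log_pos one_lt_two) three_pos, ?_⟩
  intro n hn V _ G hV hconn hG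
  classical
  obtain ⟨m, hm, hm'⟩ := Nat.exists_two_pow_quadratic_le_lt hn
  obtain ⟨v⟩ := hconn.nonempty
  obtain ⟨T, -, hT, hTk⟩ := SimpleGraph.hasLargeRootedTrees_two_pow hG m Finset.univ v
    (Finset.mem_univ v) (fun x _ => hconn.reachableWithin_univ v x)
    (by rw [Finset.card_univ, hV]; exact hm)
  refine ⟨T, hT.isTree, (Real.exp_sqrt_log_le_two_pow hn hm').trans ?_⟩
  exact_mod_cast hTk
end

section
/- Let G be a connected triangle-free simple graph and let W ⊆ V(G) be a set of m vertices with m ≥ 3. Suppose there is an integer t with 3 ≤ t such that every induced tree in G contains at most t vertices of W. Then there exists a constant C > 0 such that for every integer n ≥ 1 there is a connected triangle-free simple graph on exactly n vertices in which every induced tree has at most C·n^(log(t−1)/log(m−1)) vertices. -/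
namespace SimpleGraph

section Retraction

variable {U V : Type*} {G : SimpleGraph V} {H : SimpleGraph U}

/-- Let `f` be a retraction onto an embedded copy of `H` that collapses every edge not lying in
the copy. The image under `f` of a walk inside `S` is constant or joins its ends inside `S`. -/
lemma Walk.eq_or_reachable_of_retraction (φ : H ↪g G) (f : V → U)
    (hf : ∀ x y, G.Adj x y → f x = f y ∨ φ (f x) = x ∧ φ (f y) = y)
    {S : Set V} {x y : S} (p : (G.induce S).Walk x y) :
    f x = f y ∨ ∃ (hx : f x ∈ φ ⁻¹' S) (hy : f y ∈ φ ⁻¹' S),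
      (H.induce (φ ⁻¹' S)).Reachable ⟨f x, hx⟩ ⟨f y, hy⟩ := by
  induction p with
  | nil => exact Or.inl rfl
  | @cons x y z hxy _ ih =>
    have hadj : G.Adj x y := hxy
    rcases hf x y hadj with h | ⟨h₁, h₂⟩
    · simpa only [h] using ih
    · have hx : f x ∈ φ ⁻¹' S := by simp [h₁]
      have hy : f y ∈ φ ⁻¹' S := by simp [h₂]
      have hr : (H.induce (φ ⁻¹' S)).Reachable ⟨f x, hx⟩ ⟨f y, hy⟩ := by
        refine Adj.reachable ?_
        rw [induce_adj, ← φ.map_adj_iff, h₁, h₂]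
        exact hadj
      right
      rcases ih with ih | ⟨_, hz, ih⟩
      · have hz : f z ∈ φ ⁻¹' S := ih ▸ hy
        refine ⟨hx, hz, ?_⟩
        simpa only [← ih] using hr
      · exact ⟨hx, hz, hr.trans ih⟩

lemma IsTree.eq_or_mem_of_retraction (φ : H ↪g G) (f : V → U)
    (hf : ∀ x y, G.Adj x y → f x = f y ∨ φ (f x) = x ∧ φ (f y) = y)
    {S : Set V} (hS : (G.induce S).IsTree) {x y : V} (hx : x ∈ S) (hy : y ∈ S) :
    f x = f y ∨ φ (f x) ∈ S ∧ φ (f y) ∈ S := by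
  obtain ⟨p⟩ := hS.connected.preconnected ⟨x, hx⟩ ⟨y, hy⟩
  rcases p.eq_or_reachable_of_retraction φ f hf with h | ⟨h₁, h₂, -⟩
  · exact Or.inl h
  · exact Or.inr ⟨h₁, h₂⟩

lemma IsAcyclic.induce_preimage (φ : H ↪g G) {S : Set V} (hS : (G.induce S).IsAcyclic) :
    (H.induce (φ ⁻¹' S)).IsAcyclic :=
  hS.comap ⟨fun u => (⟨φ u, u.2⟩ : S), fun h => φ.map_adj_iff.2 h⟩ fun _ _ h =>
    Subtype.ext (φ.injective (congrArg Subtype.val h))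

lemma IsTree.induce_preimage_of_retraction (φ : H ↪g G) (f : V → U)
    (hf : ∀ x y, G.Adj x y → f x = f y ∨ φ (f x) = x ∧ φ (f y) = y)
    (hφ : ∀ u, f (φ u) = u) {S : Set V} (hS : (G.induce S).IsTree)
    (hne : (φ ⁻¹' S).Nonempty) : (H.induce (φ ⁻¹' S)).IsTree := by
  have : Nonempty (φ ⁻¹' S) := hne.to_subtype
  refine ⟨⟨fun a b => ?_⟩, hS.isAcyclic.induce_preimage φ⟩
  obtain ⟨p⟩ := hS.connected.preconnected ⟨φ a, a.2⟩ ⟨φ b, b.2⟩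
  rcases p.eq_or_reachable_of_retraction φ f hf with h | ⟨_, _, h⟩
  · have : a = b := Subtype.ext (by simpa only [hφ] using h)
    rw [this]
  · simpa only [hφ] using h

lemma IsTree.induce_image (φ : H ↪g G) {S : Set U} (hS : (H.induce S).IsTree) :
    (G.induce (φ '' S)).IsTree := by
  let e : H.induce S ≃g G.induce (φ '' S) :=
    ⟨Equiv.Set.image φ S φ.injective, φ.map_adj_iff⟩
  exact e.isTree_iff.1 hS

end Retraction

lemma Connected.exists_embedding_fin {U : Type*} [Finite U] {H : SimpleGraph U}
    (hH : H.Connected) {n : ℕ} (hn : 1 ≤ n) (hU : n ≤ Nat.card U) :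
    ∃ H' : SimpleGraph (Fin n), H'.Connected ∧ Nonempty (H' ↪g H) := by
  induction hk : Nat.card U - n generalizing U with
  | zero =>
    have hc : n = Nat.card U := by omega
    let e : Fin n ≃ U := (finCongr hc).trans (Finite.equivFin U).symm
    exact ⟨H.comap e, (Iso.comap e H).connected_iff.2 hH, ⟨(Iso.comap e H).toEmbedding⟩⟩
  | succ k ih =>
    have : Nontrivial U := Finite.one_lt_card_iff_nontrivial.1 (by omega)
    obtain ⟨v, hv⟩ := hH.exists_connected_induce_compl_singleton_of_finite_nontrivial
    have hc : Nat.card ({v}ᶜ : Set U) = Nat.card U - 1 := by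
      rw [Nat.card_coe_set_eq, Set.ncard_compl, Set.ncard_singleton]
    obtain ⟨H', hH', ⟨φ⟩⟩ := ih hv (by omega) (by omega)
    exact ⟨H', hH', ⟨(Embedding.induce _).comp φ⟩⟩

section Attach

variable {U V : Type*} (G : SimpleGraph V) (A : Finset V) (H : SimpleGraph U) (r : U)

/-- The graph obtained from `G` by taking, for each `a ∈ A`, a copy of `H` and joining its vertex
`r` to `a`. -/
def attachCopies : SimpleGraph (V ⊕ A × U) where
  Adj
    | .inl a, .inl b => G.Adj a b
    | .inl a, .inr p => a = p.1 ∧ p.2 = r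
    | .inr p, .inl a => a = p.1 ∧ p.2 = r
    | .inr p, .inr q => p.1 = q.1 ∧ H.Adj p.2 q.2
  symm := ⟨by
    rintro (a | p) (b | q) h
    · exact Adj.symm (G := G) h
    · exact h
    · exact h
    · exact ⟨h.1.symm, Adj.symm (G := H) h.2⟩⟩
  loopless := ⟨by
    rintro (a | p) h
    · exact G.irrefl h
    · exact H.irrefl h.2⟩

@[simp] lemma attachCopies_adj_inl_inl {a b : V} :
    (attachCopies G A H r).Adj (.inl a) (.inl b) ↔ G.Adj a b := Iff.rfl

@[simp] lemma attachCopies_adj_inl_inr {a : V} {p : A × U} :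
    (attachCopies G A H r).Adj (.inl a) (.inr p) ↔ a = p.1 ∧ p.2 = r := Iff.rfl

@[simp] lemma attachCopies_adj_inr_inl {a : V} {p : A × U} :
    (attachCopies G A H r).Adj (.inr p) (.inl a) ↔ a = p.1 ∧ p.2 = r := Iff.rfl

@[simp] lemma attachCopies_adj_inr_inr {p q : A × U} :
    (attachCopies G A H r).Adj (.inr p) (.inr q) ↔ p.1 = q.1 ∧ H.Adj p.2 q.2 := Iff.rfl

/-- The embedding of the base graph. -/
def attachCopiesBase : G ↪g attachCopies G A H r := ⟨⟨Sum.inl, Sum.inl_injective⟩, Iff.rfl⟩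

/-- The embedding of the copy of `H` attached at `a`. -/
def attachCopiesCopy (a : A) : H ↪g attachCopies G A H r :=
  ⟨⟨fun u => Sum.inr (a, u), Sum.inr_injective.comp (Prod.mk_right_injective a)⟩,
    and_iff_right rfl⟩

@[simp] lemma attachCopiesBase_apply (v : V) : attachCopiesBase G A H r v = .inl v := rfl

@[simp] lemma attachCopiesCopy_apply (a : A) (u : U) :
    attachCopiesCopy G A H r a u = .inr (a, u) := rfl

/-- The retraction onto the base graph, contracting each copy of `H` into the vertex it is
attached at. -/
def toBase : V ⊕ A × U → V := Sum.elim id fun p => p.1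

open Classical in
/-- The retraction onto the copy attached at `a`, contracting everything else into its root. -/
noncomputable def toCopy (a : A) : V ⊕ A × U → U :=
  Sum.elim (fun _ => r) fun p => if p.1 = a then p.2 else r

variable {G A H r}

lemma toBase_spec (x y : V ⊕ A × U) (h : (attachCopies G A H r).Adj x y) :
    toBase A x = toBase A y ∨ attachCopiesBase G A H r (toBase A x) = x ∧
      attachCopiesBase G A H r (toBase A y) = y := by
  rcases x with x | ⟨w, u⟩ <;> rcases y with y | ⟨w', u'⟩ <;>
    simp_all [toBase]

lemma toCopy_spec (a : A) (x y : V ⊕ A × U) (h : (attachCopies G A H r).Adj x y) :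
    toCopy A r a x = toCopy A r a y ∨ attachCopiesCopy G A H r a (toCopy A r a x) = x ∧
      attachCopiesCopy G A H r a (toCopy A r a y) = y := by
  rcases x with x | ⟨w, u⟩ <;> rcases y with y | ⟨w', u'⟩
  · simp [toCopy]
  · simp_all [toCopy]
  · simp_all [toCopy]
  · obtain ⟨rfl, -⟩ := h
    by_cases hw : w = a <;> simp_all [toCopy]

lemma Connected.attachCopies (hG : G.Connected) (hH : H.Connected) :
    (attachCopies G A H r).Connected := by
  obtain ⟨v⟩ := hG.nonempty
  rw [connected_iff_exists_forall_reachable]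
  refine ⟨.inl v, ?_⟩
  have hbase (x : V) : (SimpleGraph.attachCopies G A H r).Reachable (.inl v) (.inl x) :=
    (hG.preconnected v x).map (attachCopiesBase G A H r).toHom
  rintro (x | ⟨w, u⟩)
  · exact hbase x
  · refine ((hbase w).trans (Adj.reachable (v := .inr (w, r)) (by simp))).trans ?_
    exact (hH.preconnected r u).map (attachCopiesCopy G A H r w).toHom

lemma CliqueFree.attachCopies (hG : G.CliqueFree 3) (hH : H.CliqueFree 3) :
    (attachCopies G A H r).CliqueFree 3 := by
  classical
  intro s hs
  obtain ⟨x, y, z, hxy, hxz, hyz, -⟩ := is3Clique_iff.1 hs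
  rcases x with x | ⟨x, x'⟩ <;> rcases y with y | ⟨y, y'⟩ <;> rcases z with z | ⟨z, z'⟩ <;>
    simp only [attachCopies_adj_inl_inl, attachCopies_adj_inl_inr, attachCopies_adj_inr_inl,
      attachCopies_adj_inr_inr] at hxy hxz hyz
  · exact hG {x, y, z} (is3Clique_triple_iff.2 ⟨hxy, hxz, hyz⟩)
  · exact hxy.ne (hxz.1.trans hyz.1.symm)
  · exact hxz.ne (hxy.1.trans hyz.1.symm)
  · exact hyz.2.ne (hxy.2.trans hxz.2.symm)
  · exact hyz.ne (hxy.1.trans hxz.1.symm)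
  · exact hxz.2.ne (hxy.2.trans hyz.2.symm)
  · exact hxy.2.ne (hxz.2.trans hyz.2.symm)
  · exact hH {x', y', z'} (is3Clique_triple_iff.2 ⟨hxy.2, hxz.2, hyz.2⟩)

lemma IsTree.card_le_of_attachCopies [Fintype V] [DecidableEq V] {f g : ℕ}
    (hroot : ∀ T : Finset U, r ∈ T → (H.induce (T : Set U)).IsTree → T.card ≤ f)
    (hall : ∀ T : Finset U, (H.induce (T : Set U)).IsTree → T.card ≤ g)
    {S : Finset (V ⊕ A × U)}
    (hS : ((attachCopies G A H r).induce (S : Set (V ⊕ A × U))).IsTree) :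
    S.toLeft = ∅ ∧ S.card ≤ g ∨ (G.induce (S.toLeft : Set V)).IsTree ∧
      S.card ≤ Fintype.card V + (S.toLeft ∩ A).card * f := by
  classical
  let fiber (a : A) : Finset U :=
    S.preimage (fun u => Sum.inr (a, u)) (attachCopiesCopy G A H r a).injective.injOn
  have mem_fiber {a : A} {u : U} : u ∈ fiber a ↔ Sum.inr (a, u) ∈ S := Finset.mem_preimage
  have fiber_isTree (a : A) (h : (fiber a).Nonempty) :
      (H.induce (fiber a : Set U)).IsTree := by
    have hc : (fiber a : Set U) = attachCopiesCopy G A H r a ⁻¹' S := Finset.coe_preimage ..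
    rw [hc]
    exact hS.induce_preimage_of_retraction _ (toCopy A r a) (toCopy_spec a) (by simp [toCopy])
      (hc ▸ h)
  rcases S.toLeft.eq_empty_or_nonempty with hL | ⟨v, hv⟩
  · refine Or.inl ⟨hL, ?_⟩
    have hinl (x : V) : Sum.inl x ∉ S := by
      rw [← Finset.mem_toLeft, hL]
      exact Finset.notMem_empty x
    obtain ⟨⟨x, hx⟩⟩ := hS.connected.nonempty
    rcases x with x | ⟨a, u⟩
    · exact absurd hx (hinl x)
    have hsub : S ⊆ (fiber a).image fun u => Sum.inr (a, u) := by
      intro y hy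
      rcases hS.eq_or_mem_of_retraction _ _ toBase_spec hy hx with h | ⟨h, -⟩
      · rcases y with y | ⟨b, w⟩
        · exact absurd hy (hinl y)
        · obtain rfl : b = a := Subtype.ext h
          exact Finset.mem_image_of_mem _ (mem_fiber.2 hy)
      · exact absurd h (hinl _)
    exact (Finset.card_le_card hsub).trans
      (Finset.card_image_le.trans (hall _ (fiber_isTree a ⟨u, mem_fiber.2 hx⟩)))
  · refine Or.inr ⟨?_, ?_⟩
    · have hc : (S.toLeft : Set V) = attachCopiesBase G A H r ⁻¹' S := by ext; simp
      rw [hc]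
      exact hS.induce_preimage_of_retraction _ (toBase A) toBase_spec (by simp [toBase])
        ⟨v, by simpa using hv⟩
    · have hvS : Sum.inl v ∈ S := Finset.mem_toLeft.1 hv
      have hfiber (a : A) : (fiber a).card ≤ f := by
        rcases (fiber a).eq_empty_or_nonempty with h | ⟨u, hu⟩
        · simp [h]
        refine hroot _ ?_ (fiber_isTree a ⟨u, hu⟩)
        rcases hS.eq_or_mem_of_retraction _ _ (toCopy_spec a) (mem_fiber.1 hu) hvS with h | ⟨-, h⟩
        · have hur : u = r := by simpa [toCopy] using h
          exact hur ▸ hu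
        · exact mem_fiber.2 (by simpa [toCopy] using h)
      let R : Finset A := {a | (a : V) ∈ S.toLeft}
      have hR : R.card ≤ (S.toLeft ∩ A).card :=
        Finset.card_le_card_of_injOn Subtype.val
          (fun a ha => Finset.mem_inter.2 ⟨(Finset.mem_filter.1 ha).2, a.2⟩)
          Subtype.val_injective.injOn
      have hsub : S ⊆ S.toLeft.image Sum.inl ∪
          R.biUnion fun a => (fiber a).image fun u => Sum.inr (a, u) := by
        rintro (x | ⟨a, u⟩) hx
        · simpa using hx
        · refine Finset.mem_union_right _ (Finset.mem_biUnion.2 ⟨a, ?_, ?_⟩)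
          · refine Finset.mem_filter.2 ⟨Finset.mem_univ _, ?_⟩
            rcases hS.eq_or_mem_of_retraction _ _ toBase_spec hx hvS with h | ⟨h, -⟩
            · have hav : (a : V) = v := h
              exact hav ▸ hv
            · exact Finset.mem_toLeft.2 h
          · exact Finset.mem_image_of_mem _ (mem_fiber.2 hx)
      calc S.card ≤ _ := Finset.card_le_card hsub
        _ ≤ _ := Finset.card_union_le _ _
        _ ≤ Fintype.card V + R.card * f :=
            add_le_add (Finset.card_image_le.trans (Finset.card_le_univ _))
              (Finset.card_biUnion_le_card_mul _ _ _ fun a _ =>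
                Finset.card_image_le.trans (hfiber a))
        _ ≤ _ := by gcongr

end Attach

/-- The iterated attachment of copies of `G` at the vertices of `W` other than a fixed one. -/
lemma exists_connected_cliqueFree_card_isTree_le {V : Type} [Fintype V] [DecidableEq V]
    {G : SimpleGraph V} (hconn : G.Connected) (htf : G.CliqueFree 3) {W : Finset V}
    (hW : W.Nonempty) {d : ℕ} (hd : 2 ≤ d)
    (htree : ∀ S : Finset V, (G.induce (S : Set V)).IsTree → (S ∩ W).card ≤ d + 1) (k : ℕ) :
    ∃ (U : Type) (_ : Finite U) (H : SimpleGraph U) (r : U), H.Connected ∧ H.CliqueFree 3 ∧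
      (W.card - 1) ^ k ≤ Nat.card U ∧
      (∀ T : Finset U, r ∈ T → (H.induce (T : Set U)).IsTree →
        T.card + Fintype.card V ≤ (Fintype.card V + 1) * d ^ k) ∧
      ∀ T : Finset U, (H.induce (T : Set U)).IsTree →
        T.card ≤ 2 * (Fintype.card V + 1) * d ^ k := by
  obtain ⟨w, hw⟩ := hW
  set g := Fintype.card V
  induction k with
  | zero =>
    have hc (T : Finset Unit) : T.card ≤ 1 := T.card_le_univ
    refine ⟨Unit, inferInstance, ⊥, (), Connected.of_subsingleton, cliqueFree_of_card_lt (by simp),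
      by simp, fun T _ _ => ?_, fun T _ => ?_⟩ <;>
    · have := hc T
      simp only [pow_zero]
      omega
  | succ k ih =>
    obtain ⟨U, _, H, r, hH, hHtf, hcard, hroot, hall⟩ := ih
    have hroot' (T : Finset U) (hr : r ∈ T) (hT : (H.induce (T : Set U)).IsTree) :
        T.card ≤ (g + 1) * d ^ k - g := Nat.le_sub_of_add_le (hroot T hr hT)
    have hg : g ≤ (g + 1) * d ^ k := by
      have : 1 ≤ d ^ k := Nat.one_le_pow _ _ (by omega)
      nlinarith
    obtain ⟨f, hf⟩ : ∃ f, (g + 1) * d ^ k = f + g := ⟨_, (Nat.sub_add_cancel hg).symm⟩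
    rw [hf, Nat.add_sub_cancel] at hroot'
    refine ⟨V ⊕ W.erase w × U, inferInstance, attachCopies G (W.erase w) H r, .inl w,
      hconn.attachCopies hH, htf.attachCopies hHtf, ?_, fun T hwT hT => ?_, fun T hT => ?_⟩
    · rw [Nat.card_sum, Nat.card_prod, Nat.card_eq_fintype_card (α := W.erase w),
        Fintype.card_coe, Finset.card_erase_of_mem hw, pow_succ']
      exact (Nat.mul_le_mul_left _ hcard).trans (Nat.le_add_left _ _)
    · rcases hT.card_le_of_attachCopies hroot' hall with ⟨h, -⟩ | ⟨h₁, h₂⟩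
      · exact absurd (Finset.mem_toLeft.2 hwT) (h ▸ Finset.notMem_empty w)
      · have h₃ : (T.toLeft ∩ W.erase w).card ≤ d := by
          rw [Finset.inter_erase, Finset.card_erase_of_mem
            (Finset.mem_inter.2 ⟨Finset.mem_toLeft.2 hwT, hw⟩)]
          exact Nat.sub_le_of_le_add (htree _ h₁)
        calc T.card + g ≤ g + d * f + g := by gcongr; exact h₂.trans (by gcongr)
          _ ≤ (f + g) * d := by nlinarith
          _ = (g + 1) * d ^ (k + 1) := by rw [← hf, pow_succ, mul_assoc]
    · rcases hT.card_le_of_attachCopies hroot' hall with ⟨-, h⟩ | ⟨h₁, h₂⟩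
      · refine h.trans ?_
        gcongr <;> omega
      · have h₃ : (T.toLeft ∩ W.erase w).card ≤ d + 1 :=
          (Finset.card_le_card (Finset.inter_subset_inter_left (Finset.erase_subset w W))).trans
            (htree _ h₁)
        calc T.card ≤ g + (d + 1) * f := h₂.trans (by gcongr)
          _ ≤ 2 * ((f + g) * d) := by nlinarith
          _ = 2 * (g + 1) * d ^ (k + 1) := by rw [← hf, pow_succ]; ring

end SimpleGraph

/-- Blow-up construction, triangle-free version. -/
theorem stmt_4 (V : Type) [Fintype V] [DecidableEq V] (G : SimpleGraph V)
    (hconn : G.Connected) (htf : G.CliqueFree 3)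
    (W : Finset V) (m : ℕ) (hW : W.card = m) (hm : 3 ≤ m)
    (t : ℕ) (ht : 3 ≤ t)
    (htree : ∀ S : Finset V, (G.induce (S : Set V)).IsTree → (S ∩ W).card ≤ t) :
    ∃ C : ℝ, 0 < C ∧ ∀ n : ℕ, 1 ≤ n →
      ∃ H : SimpleGraph (Fin n), H.Connected ∧ H.CliqueFree 3 ∧
        ∀ S : Finset (Fin n), (H.induce (S : Set (Fin n))).IsTree →
          (S.card : ℝ) ≤ C * (n : ℝ) ^ (Real.log ((t : ℝ) - 1) / Real.log ((m : ℝ) - 1)) := by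
  have hM : 1 < m - 1 := by omega
  have hmR : (1 : ℝ) < (m : ℝ) - 1 := by
    have : (3 : ℝ) ≤ m := by exact_mod_cast hm
    linarith
  have htR : (1 : ℝ) < (t : ℝ) - 1 := by
    have : (3 : ℝ) ≤ t := by exact_mod_cast ht
    linarith
  set α := Real.log ((t : ℝ) - 1) / Real.log ((m : ℝ) - 1) with hα
  have hα0 : 0 ≤ α := div_nonneg (Real.log_pos htR).le (Real.log_pos hmR).le
  have hpow : ((m : ℝ) - 1) ^ α = (t : ℝ) - 1 := by
    rw [Real.rpow_def_of_pos (by linarith), hα, mul_div_cancel₀ _ (Real.log_pos hmR).ne',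
      Real.exp_log (by linarith)]
  refine ⟨2 * (Fintype.card V + 1) * ((t : ℝ) - 1), by positivity, fun n hn => ?_⟩
  obtain ⟨U, _, H, -, hH, hHtf, hcard, -, hall⟩ :=
    SimpleGraph.exists_connected_cliqueFree_card_isTree_le hconn htf (W := W)
      (Finset.card_pos.1 (by omega)) (d := t - 1) (by omega)
      (by simpa only [Nat.sub_add_cancel (show 1 ≤ t by omega)] using htree) (Nat.clog (m - 1) n)
  rw [hW] at hcard
  obtain ⟨H', hH', ⟨φ⟩⟩ := hH.exists_embedding_fin hn ((Nat.le_pow_clog hM n).trans hcard)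
  refine ⟨H', hH', hHtf.comap φ.isContained, fun S hS => ?_⟩
  have hS' := hall (S.map φ.toEmbedding) (by
    rw [Finset.coe_map]
    exact hS.induce_image φ)
  rw [Finset.card_map] at hS'
  have hclog : (m - 1) ^ Nat.clog (m - 1) n ≤ (m - 1) * n := by
    rcases hn.eq_or_lt with rfl | hn
    · simp; omega
    · rw [← Nat.succ_pred_eq_of_pos (Nat.clog_pos hM hn), pow_succ']
      exact Nat.mul_le_mul_left _ (Nat.pow_pred_clog_lt_self hM hn).le
  have hclogR : ((m : ℝ) - 1) ^ Nat.clog (m - 1) n ≤ ((m : ℝ) - 1) * n := by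
    have := (Nat.cast_le (α := ℝ)).2 hclog
    push_cast [Nat.cast_sub (show 1 ≤ m by omega)] at this
    exact this
  have hSR := (Nat.cast_le (α := ℝ)).2 hS'
  push_cast [Nat.cast_sub (show 1 ≤ t by omega)] at hSR
  calc (S.card : ℝ) ≤ 2 * (Fintype.card V + 1) * ((t : ℝ) - 1) ^ Nat.clog (m - 1) n := hSR
    _ = 2 * (Fintype.card V + 1) * (((m : ℝ) - 1) ^ Nat.clog (m - 1) n) ^ α := by
      rw [← hpow, Real.rpow_pow_comm (by linarith)]
    _ ≤ 2 * (Fintype.card V + 1) * (((m : ℝ) - 1) * n) ^ α := by gcongr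
    _ = 2 * (Fintype.card V + 1) * ((t : ℝ) - 1) * (n : ℝ) ^ α := by
      rw [Real.mul_rpow (by linarith) (by positivity), hpow]
      ring
end

section
/- Suppose there exist an integer n₀ ≥ 3 and a connected triangle-free simple graph G₀ on exactly n₀ vertices such that every induced tree in G₀ has fewer than √n₀ vertices. Then there exist constants ε > 0 and C > 0 such that for every integer n ≥ 1 there is a connected triangle-free simple graph on exactly n vertices in which every induced tree has at most C·n^(1/2 − ε) vertices. -/
namespace SimpleGraph

variable {V W : Type*}

/-- Every induced tree of `G` has at most `t` vertices. -/
def InducedTreesLE (G : SimpleGraph V) (t : ℕ) : Prop :=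
  ∀ S : Finset V, (G.induce (S : Set V)).IsTree → S.card ≤ t

lemma InducedTreesLE.card_le {G : SimpleGraph V} {t : ℕ} (hG : G.InducedTreesLE t) [Fintype W]
    {T : SimpleGraph W} (hT : T.IsTree) (f : T ↪g G) : Fintype.card W ≤ t := by
  have h := hG (Finset.univ.map f.toEmbedding)
  rw [Finset.card_map, Finset.card_univ] at h
  apply h
  have hS : ((Finset.univ.map f.toEmbedding : Finset V) : Set V) = Set.range f := by
    ext; simp
  rw [hS]
  exact f.isoInduceRange.isTree_iff.mp hT

lemma InducedTreesLE.comap {G : SimpleGraph V} {H : SimpleGraph W} {t : ℕ}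
    (hG : G.InducedTreesLE t) (f : H ↪g G) : H.InducedTreesLE t := by
  intro S hS
  have h := hG.card_le hS ((Embedding.induce (S : Set W)).trans f)
  simpa using h

/-- A surjective map sending adjacent vertices to equal or adjacent vertices
preserves connectedness. -/
lemma Connected.of_surjective_of_adj {G : SimpleGraph V} {H : SimpleGraph W} (hG : G.Connected)
    (φ : V → W) (hφ : φ.Surjective)
    (hadj : ∀ a b, G.Adj a b → φ a = φ b ∨ H.Adj (φ a) (φ b)) : H.Connected := by
  have key : ∀ a b, G.Walk a b → H.Reachable (φ a) (φ b) := by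
    intro a b p
    induction p with
    | nil => exact Reachable.rfl
    | cons h _ ih =>
      rcases hadj _ _ h with h | h
      · rwa [h]
      · exact h.reachable.trans ih
  have := hG.nonempty.map φ
  refine ⟨fun x y => ?_⟩
  obtain ⟨a, rfl⟩ := hφ x
  obtain ⟨b, rfl⟩ := hφ y
  obtain ⟨p⟩ := hG.preconnected a b
  exact key a b p

/-- The rooted product: a copy of `H` is attached to every vertex of `G`, the root `r`
of the copy being identified with that vertex. -/
def rootedProd (G : SimpleGraph V) (H : SimpleGraph W) (r : W) : SimpleGraph (V × W) where
  Adj p q := (p.1 = q.1 ∧ H.Adj p.2 q.2) ∨ (p.2 = r ∧ q.2 = r ∧ G.Adj p.1 q.1)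
  symm := ⟨by
    rintro p q (⟨h, h'⟩ | ⟨h, h', h''⟩)
    · exact Or.inl ⟨h.symm, h'.symm⟩
    · exact Or.inr ⟨h', h, h''.symm⟩⟩
  loopless := ⟨by
    rintro p (⟨-, h⟩ | ⟨-, -, h⟩)
    · exact h.ne rfl
    · exact h.ne rfl⟩

variable {G : SimpleGraph V} {H : SimpleGraph W} {r : W}

/-- The copy of `G` on the roots. -/
def rootedProdBase (G : SimpleGraph V) (H : SimpleGraph W) (r : W) : G →g rootedProd G H r where
  toFun v := (v, r)
  map_rel' h := Or.inr ⟨rfl, rfl, h⟩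

/-- The copy of `H` at the vertex `v`. -/
def rootedProdFiber (G : SimpleGraph V) (H : SimpleGraph W) (r : W) (v : V) :
    H →g rootedProd G H r where
  toFun w := (v, w)
  map_rel' h := Or.inl ⟨rfl, h⟩

lemma Connected.rootedProd (hG : G.Connected) (hH : H.Connected) :
    (rootedProd G H r).Connected := by
  obtain ⟨v₀⟩ := hG.nonempty
  refine connected_iff_exists_forall_reachable _ |>.mpr ⟨(v₀, r), fun ⟨v, w⟩ => ?_⟩
  exact ((hG.preconnected v₀ v).map (rootedProdBase G H r)).trans
    ((hH.preconnected r w).map (rootedProdFiber G H r v))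

lemma CliqueFree.rootedProd (hG : G.CliqueFree 3) (hH : H.CliqueFree 3) :
    (rootedProd G H r).CliqueFree 3 := by
  classical
  intro s hs
  obtain ⟨⟨a, a'⟩, ⟨b, b'⟩, ⟨c, c'⟩, hab, hac, hbc, -⟩ := is3Clique_iff.mp hs
  have hG' : ∀ a b c, G.Adj a b → G.Adj a c → G.Adj b c → False := fun a b c h₁ h₂ h₃ =>
    hG {a, b, c} (is3Clique_triple_iff.mpr ⟨h₁, h₂, h₃⟩)
  have hH' : ∀ a b c, H.Adj a b → H.Adj a c → H.Adj b c → False := fun a b c h₁ h₂ h₃ =>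
    hH {a, b, c} (is3Clique_triple_iff.mpr ⟨h₁, h₂, h₃⟩)
  simp only [SimpleGraph.rootedProd] at hab hac hbc
  grind

section Fibers

variable {T : Finset (V × W)}

lemma root_mem_or_fst_eq_of_connected
    (hT : ((rootedProd G H r).induce (T : Set (V × W))).Connected) {v : V} {w : W}
    (hw : (v, w) ∈ T) : (v, r) ∈ T ∨ ∀ p ∈ T, p.1 = v := by
  refine or_iff_not_imp_left.mpr fun hr p hp => ?_
  have key : ∀ x y, ((rootedProd G H r).induce (T : Set (V × W))).Walk x y →
      x.1.1 = v → y.1.1 = v := by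
    intro x y q
    induction q with
    | nil => exact id
    | @cons x y z h _ ih =>
      intro hx
      apply ih
      rcases h with ⟨h, -⟩ | ⟨h, -, -⟩
      · exact h.symm.trans hx
      · refine absurd x.2 ?_
        rwa [show x.1 = (v, r) from Prod.ext hx h]
  obtain ⟨q⟩ := hT.preconnected ⟨(v, w), hw⟩ ⟨p, hp⟩
  exact key _ _ q rfl

lemma isTree_induce_fiber (hT : ((rootedProd G H r).induce (T : Set (V × W))).IsTree) {v : V}
    {F : Finset W} (hF : ∀ w, w ∈ F ↔ (v, w) ∈ T) {w₀ : W} (hw₀ : (v, w₀) ∈ T) :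
    (H.induce (F : Set W)).IsTree := by
  classical
  have hr := root_mem_or_fst_eq_of_connected hT.connected hw₀
  have hφ : ∀ p ∈ T, (if p.1 = v then p.2 else r) ∈ F := by
    intro p hp
    split_ifs with h
    · rw [hF, ← h]
      exact hp
    · rw [hF]
      exact hr.resolve_right fun h' => h (h' p hp)
  refine ⟨hT.connected.of_surjective_of_adj (fun p => ⟨_, hφ p.1 p.2⟩) ?_ ?_, ?_⟩
  · rintro ⟨w, hw⟩
    exact ⟨⟨(v, w), (hF w).mp hw⟩, by simp⟩
  · rintro ⟨⟨a, a'⟩, ha⟩ ⟨⟨b, b'⟩, hb⟩ (⟨h, h'⟩ | ⟨h, h', -⟩)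
    · dsimp only [Function.Embedding.subtype_apply] at h h'
      subst h
      by_cases hav : a = v
      · right
        simpa [hav] using h'
      · left
        simp [hav]
    · dsimp only [Function.Embedding.subtype_apply] at h h'
      subst h h'
      left
      simp
  · refine hT.isAcyclic.comap
      ⟨fun w => ⟨(v, w.1), (hF w.1).mp w.2⟩, fun h => Or.inl ⟨rfl, h⟩⟩ ?_
    intro a b hab
    exact Subtype.ext (congrArg (fun p => p.1.2) hab)

lemma isTree_induce_base (hT : ((rootedProd G H r).induce (T : Set (V × W))).IsTree)
    {B : Finset V} (hB : ∀ v, v ∈ B ↔ ∃ w, (v, w) ∈ T) (hr : ∀ v ∈ B, (v, r) ∈ T) :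
    (G.induce (B : Set V)).IsTree := by
  refine ⟨hT.connected.of_surjective_of_adj
    (fun p => ⟨p.1.1, (hB _).mpr ⟨p.1.2, p.2⟩⟩) ?_ ?_, ?_⟩
  · rintro ⟨v, hv⟩
    exact ⟨⟨(v, r), hr v hv⟩, rfl⟩
  · rintro a b (⟨h, -⟩ | ⟨-, -, h⟩)
    · exact Or.inl (Subtype.ext h)
    · exact Or.inr h
  · refine hT.isAcyclic.comap
      ⟨fun v => ⟨(v.1, r), hr v.1 v.2⟩, fun h => Or.inr ⟨rfl, rfl, h⟩⟩ ?_
    intro a b hab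
    exact Subtype.ext (congrArg (fun p => p.1.1) hab)

end Fibers

lemma InducedTreesLE.rootedProd {s t : ℕ} (hG : G.InducedTreesLE s) (hs : 1 ≤ s)
    (hH : H.InducedTreesLE t) : (rootedProd G H r).InducedTreesLE (s * t) := by
  classical
  intro T hT
  have hbase : (T.image Prod.fst).card ≤ s := by
    by_cases hr : ∀ v ∈ T.image Prod.fst, (v, r) ∈ T
    · exact hG _ (isTree_induce_base hT (by simp) hr)
    · push Not at hr
      obtain ⟨v, hv, hvr⟩ := hr
      obtain ⟨p, hp, rfl⟩ := Finset.mem_image.mp hv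
      have h := (root_mem_or_fst_eq_of_connected hT.connected hp).resolve_left hvr
      refine le_trans (Finset.card_le_one.mpr ?_) hs
      intro a ha b hb
      obtain ⟨x, hx, rfl⟩ := Finset.mem_image.mp ha
      obtain ⟨y, hy, rfl⟩ := Finset.mem_image.mp hb
      rw [h x hx, h y hy]
  have hfiber : ∀ v ∈ T.image Prod.fst, (T.filter fun p => p.1 = v).card ≤ t := by
    intro v hv
    obtain ⟨p, hp, rfl⟩ := Finset.mem_image.mp hv
    have hinj : Set.InjOn Prod.snd (T.filter fun q => q.1 = p.1 : Set (V × W)) := by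
      intro x hx y hy hxy
      simp only [Finset.coe_filter, Set.mem_ofPred_eq] at hx hy
      exact Prod.ext (hx.2.trans hy.2.symm) hxy
    rw [← Finset.card_image_of_injOn hinj]
    exact hH _ (isTree_induce_fiber hT (v := p.1) (by simp) hp)
  calc T.card ≤ t * (T.image Prod.fst).card := Finset.card_le_mul_card_image T t hfiber
    _ ≤ t * s := Nat.mul_le_mul_left t hbase
    _ = s * t := mul_comm t s

/-- Some connected triangle-free graph on `n` vertices has all induced trees of size at
most `t`. -/
def HasSmallTreesGraph (n t : ℕ) : Prop :=
  ∃ H : SimpleGraph (Fin n), H.Connected ∧ H.CliqueFree 3 ∧ H.InducedTreesLE t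

lemma HasSmallTreesGraph.of_card [Fintype V] {n t : ℕ} (hV : Fintype.card V = n)
    (hc : G.Connected) (hf : G.CliqueFree 3) (ht : G.InducedTreesLE t) :
    HasSmallTreesGraph n t := by
  let e := Fintype.equivFinOfCardEq hV
  let f : G.comap e.symm ≃g G := Iso.comap e.symm G
  exact ⟨_, f.connected_iff.mpr hc, hf.comap ⟨f.toCopy⟩, ht.comap f.toEmbedding⟩

lemma HasSmallTreesGraph.mul {m n s t : ℕ} (hs : 1 ≤ s) (h : HasSmallTreesGraph m s)
    (h' : HasSmallTreesGraph n t) : HasSmallTreesGraph (m * n) (s * t) := by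
  obtain ⟨G, hG, hG', hG''⟩ := h
  obtain ⟨H, hH, hH', hH''⟩ := h'
  obtain ⟨r⟩ := hH.nonempty
  exact .of_card (G := G.rootedProd H r) (by simp) (hG.rootedProd hH) (hG'.rootedProd hH')
    (hG''.rootedProd hs hH'')

lemma HasSmallTreesGraph.pow {m s : ℕ} (hs : 1 ≤ s) (h : HasSmallTreesGraph m s) (k : ℕ) :
    HasSmallTreesGraph (m ^ (k + 1)) (s ^ (k + 1)) := by
  induction k with
  | zero => simpa using h
  | succ k ih =>
    rw [pow_succ' m, pow_succ' s]
    exact h.mul hs ih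

lemma HasSmallTreesGraph.anti {m n t : ℕ} (hm : 1 ≤ m) (hmn : m ≤ n)
    (h : HasSmallTreesGraph n t) : HasSmallTreesGraph m t := by
  induction n, hmn using Nat.le_induction with
  | base => exact h
  | succ n hn ih =>
    apply ih
    obtain ⟨G, hc, hf, ht⟩ := h
    have : Nontrivial (Fin (n + 1)) := Fin.nontrivial_iff_two_le.mpr (by lia)
    obtain ⟨v, hv⟩ := hc.exists_connected_induce_compl_singleton_of_finite_nontrivial
    exact .of_card (by rw [Fintype.card_compl_set]; simp) hv
      (hf.comap ⟨(Embedding.induce _).toCopy⟩) (ht.comap (Embedding.induce _))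

end SimpleGraph

lemma pow_log_succ_le_mul_rpow_logb {b t n : ℕ} (hb : 1 < b) (ht : 1 ≤ t) (hn : 1 ≤ n) :
    ((t ^ (Nat.log b n + 1) : ℕ) : ℝ) ≤ t * (n : ℝ) ^ Real.logb b t := by
  have hb' : (1 : ℝ) < b := by exact_mod_cast hb
  have ht' : (1 : ℝ) ≤ t := by exact_mod_cast ht
  have hpow : ((t : ℝ) ^ Nat.log b n) = ((b : ℝ) ^ Nat.log b n) ^ Real.logb b t := by
    rw [← Real.rpow_natCast, ← Real.rpow_natCast, ← Real.rpow_mul (by positivity), mul_comm,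
      Real.rpow_mul (by positivity), Real.rpow_logb (by positivity) hb'.ne' (by positivity)]
  push_cast
  rw [pow_succ', hpow]
  gcongr
  · exact Real.logb_nonneg hb' ht'
  · exact_mod_cast Nat.pow_log_le_self b (by lia)

/-- If some connected triangle-free graph on `n₀` vertices has all induced trees of
size `< √n₀`, then `f_T(n) = O(n^(1/2 - ε))` for some `ε > 0`. -/
theorem stmt_6 (n₀ : ℕ) (hn₀ : 3 ≤ n₀) (G₀ : SimpleGraph (Fin n₀))
    (hconn : G₀.Connected) (htf : G₀.CliqueFree 3)
    (hsmall : ∀ S : Finset (Fin n₀), (G₀.induce (S : Set (Fin n₀))).IsTree →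
      (S.card : ℝ) < Real.sqrt n₀) :
    ∃ ε C : ℝ, 0 < ε ∧ 0 < C ∧ ∀ n : ℕ, 1 ≤ n →
      ∃ H : SimpleGraph (Fin n), H.Connected ∧ H.CliqueFree 3 ∧
        ∀ S : Finset (Fin n), (H.induce (S : Set (Fin n))).IsTree →
          (S.card : ℝ) ≤ C * (n : ℝ) ^ ((1 : ℝ) / 2 - ε) := by
  set t := Nat.sqrt (n₀ - 1)
  have ht : 1 ≤ t := Nat.le_sqrt.mpr (by lia)
  have htn : t ^ 2 < n₀ := by
    have := Nat.sqrt_le' (n₀ - 1)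
    lia
  have hG₀ : SimpleGraph.HasSmallTreesGraph n₀ t := by
    refine ⟨G₀, hconn, htf, fun S hS => Nat.le_sqrt'.mpr (Nat.le_sub_one_of_lt ?_)⟩
    exact_mod_cast (Real.lt_sqrt (Nat.cast_nonneg _)).mp (hsmall S hS)
  have hlog : Real.logb n₀ t < 1 / 2 := by
    have hn₀' : (1 : ℝ) < n₀ := by exact_mod_cast (by lia : 1 < n₀)
    have h : Real.logb n₀ ((t : ℝ) ^ 2) < Real.logb n₀ n₀ :=
      Real.logb_lt_logb hn₀' (by positivity) (by exact_mod_cast htn)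
    rw [Real.logb_pow, Real.logb_self_eq_one hn₀'] at h
    push_cast at h
    linarith
  refine ⟨1 / 2 - Real.logb n₀ t, t, by linarith, by positivity, fun n hn => ?_⟩
  obtain ⟨H, hc, hf, hH⟩ := (hG₀.pow ht (Nat.log n₀ n)).anti hn
    (Nat.lt_pow_succ_log_self (by lia) n).le
  refine ⟨H, hc, hf, fun S hS => ?_⟩
  rw [sub_sub_cancel]
  exact le_trans (by exact_mod_cast hH S hS) (pow_log_succ_le_mul_rpow_logb (by lia) ht hn)
end
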